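/- arXiv:0707.4202 — 2 statements merged into one kernel-verified Lean document; each statement's English description precedes it below -/
import Mathlib

section
/- Let (A,S) be an admissible arrival–service pair. Then for all real r < s, the number of unused service times in (r,s] equals the decrease of the running minimum of Z over that interval: |U(A,S) ∩ (r,s]| = min_{r' ≤ r} Z_{r'} − min_{r' ≤ s} Z_{r'}. -/
open Set Filter Classical

noncomputable section

/-- A subset of `ℝ` is locally finite if its intersection with every bounded interval
is finite. -/
def LocFin (B : Set ℝ) : Prop := ∀ a b : ℝ, (B ∩ Set.Icc a b).Finite

/-- The right-continuous random-walk function `Z` associated to arrivals `A` and services `S`: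
`Z 0 = 0` and `Z s - Z r = |A ∩ (r,s]| - |S ∩ (r,s]|` for `r < s`;
`Z` jumps up by 1 at points of `A` and down by 1 at points of `S`. -/
def Zfun (A S : Set ℝ) (r : ℝ) : ℤ :=
  if 0 ≤ r then ((A ∩ Set.Ioc 0 r).ncard : ℤ) - ((S ∩ Set.Ioc 0 r).ncard : ℤ)
  else ((S ∩ Set.Ioc r 0).ncard : ℤ) - ((A ∩ Set.Ioc r 0).ncard : ℤ)

/-- The pair `(A,S)` is admissible: both sets locally finite and disjoint, and
`Z_r → -∞` as `r → ∞`, `Z_r → +∞` as `r → -∞`. -/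
def Admissible (A S : Set ℝ) : Prop :=
  LocFin A ∧ LocFin S ∧ Disjoint A S ∧
  Tendsto (Zfun A S) atTop atBot ∧ Tendsto (Zfun A S) atBot atTop

/-- Unused service times: times `r ∈ S` where `Z` attains a new record down, i.e.
`Z r < Z r'` for all `r' < r` (equivalently `Z_r < inf_{r' < r} Z_{r'}`). -/
def Unused (A S : Set ℝ) : Set ℝ := {r ∈ S | ∀ r' < r, Zfun A S r < Zfun A S r'}

/-- Departure times: service times that are not unused. -/
def Dep (A S : Set ℝ) : Set ℝ := S \ Unused A S

/-- `B` has two-sided density `ρ`. -/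
def HasDens (B : Set ℝ) (ρ : ℝ) : Prop :=
  Tendsto (fun s : ℝ => ((B ∩ Set.Icc 0 s).ncard : ℝ) / s) atTop (nhds ρ) ∧
  Tendsto (fun s : ℝ => ((B ∩ Set.Icc (-s) 0).ncard : ℝ) / s) atTop (nhds ρ)

/-- The queue length `Q_r = Z_r - min_{r' ≤ r} Z_{r'}`. -/
def Qlen (A S : Set ℝ) (r : ℝ) : ℤ := Zfun A S r - sInf (Zfun A S '' Set.Iic r)

/-- `Dseq α k m = D^{(m+1)}(α_k, α_{k+1}, …, α_{k+m})`, the tandem departure operator: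
`D^{(1)}(α¹) = α¹` and `D^{(n)}(α¹,…,αⁿ) = D(D^{(n-1)}(α¹,…,α^{n-1}), αⁿ)`. -/
def Dseq (α : ℕ → Set ℝ) (k : ℕ) : ℕ → Set ℝ
  | 0 => α k
  | m + 1 => Dep (Dseq α k m) (α (k + m + 1))


lemma aux_split {B : Set ℝ} (hB : LocFin B) {a b c : ℝ} (hab : a ≤ b) (hbc : b ≤ c) :
    (B ∩ Set.Ioc a c).ncard = (B ∩ Set.Ioc a b).ncard + (B ∩ Set.Ioc b c).ncard := by
  have hf : ∀ u v, (B ∩ Set.Ioc u v).Finite := fun u v =>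
    (hB u v).subset (Set.inter_subset_inter_right _ Set.Ioc_subset_Icc_self)
  rw [← Set.Ioc_union_Ioc_eq_Ioc hab hbc, Set.inter_union_distrib_left]
  apply Set.ncard_union_eq _ (hf _ _) (hf _ _)
  rw [Set.disjoint_left]
  rintro x ⟨_, h1⟩ ⟨_, h2⟩
  exact absurd h1.2 (not_le.mpr h2.1)

lemma aux_incr {A S : Set ℝ} (hA : LocFin A) (hS : LocFin S) {u t : ℝ} (hut : u ≤ t) :
    Zfun A S t - Zfun A S u =
      ((A ∩ Set.Ioc u t).ncard : ℤ) - ((S ∩ Set.Ioc u t).ncard : ℤ) := by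
  unfold Zfun
  split_ifs with h1 h2 h2
  · have e1 := aux_split hA h2 hut
    have e2 := aux_split hS h2 hut
    omega
  · have e1 := aux_split hA (not_le.mp h2).le h1
    have e2 := aux_split hS (not_le.mp h2).le h1
    omega
  · exact absurd (h2.trans hut) h1
  · have e1 := aux_split hA hut (not_le.mp h1).le
    have e2 := aux_split hS hut (not_le.mp h1).le
    omega

lemma aux_gap {B : Set ℝ} (hB : LocFin B) (p : ℝ) :
    ∃ e > 0, ∀ x ∈ B, x ≠ p → e ≤ |x - p| := by
  have hc : IsClosed ((B ∩ Set.Icc (p - 1) (p + 1)) \ {p}) :=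
    ((hB (p - 1) (p + 1)).subset Set.diff_subset).isClosed
  have hn : ((B ∩ Set.Icc (p - 1) (p + 1)) \ {p})ᶜ ∈ nhds p :=
    hc.isOpen_compl.mem_nhds (by simp)
  obtain ⟨e, he, hb⟩ := Metric.mem_nhds_iff.mp hn
  refine ⟨min e 1, lt_min he one_pos, fun x hx hxp => ?_⟩
  by_contra hlt
  rw [not_le, lt_min_iff] at hlt
  have h1 : x ∈ Metric.ball p e := by rw [Metric.mem_ball, Real.dist_eq]; exact hlt.1
  have h2 := abs_lt.mp hlt.2
  exact hb h1 ⟨⟨hx, by linarith, by linarith⟩, hxp⟩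

lemma aux_bdd {A S : Set ℝ} (h : Admissible A S) (s : ℝ) :
    BddBelow (Zfun A S '' Set.Iic s) := by
  obtain ⟨hA, hS, hd, h1, h2⟩ := h
  obtain ⟨a, ha⟩ := Filter.eventually_atBot.mp (h2.eventually_ge_atTop 0)
  refine ⟨min 0 (-((S ∩ Set.Ioc a s).ncard : ℤ)), ?_⟩
  rintro _ ⟨t, ht, rfl⟩
  rcases le_total t a with hta | hta
  · exact (min_le_left _ _).trans (ha t hta)
  · refine (min_le_right _ _).trans ?_
    have e := aux_incr hA hS hta
    have e2 := aux_split hS hta ht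
    have := ha a le_rfl
    omega

lemma aux_surj {A S : Set ℝ} (h : Admissible A S) {s : ℝ} {k : ℤ}
    (hk : ∃ t ≤ s, Zfun A S t ≤ k) :
    ∃ p ≤ s, p ∈ Unused A S ∧ Zfun A S p = k := by
  obtain ⟨hA, hS, hd, h1, h2⟩ := h
  obtain ⟨a, ha⟩ := Filter.eventually_atBot.mp (h2.eventually_gt_atTop k)
  set T : Set ℝ := {t | t ≤ s ∧ Zfun A S t ≤ k} with hT
  have hne : T.Nonempty := by obtain ⟨t, h3, h4⟩ := hk; exact ⟨t, h3, h4⟩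
  have hbd : BddBelow T := ⟨a, fun t ht => by
    by_contra hlt
    exact absurd (ha t (not_le.mp hlt).le) (not_lt.mpr ht.2)⟩
  obtain ⟨e1, he1, g1⟩ := aux_gap hA (sInf T)
  obtain ⟨e2, he2, g2⟩ := aux_gap hS (sInf T)
  set p := sInf T with hp
  have hlt : ∀ t < p, t ≤ s → k < Zfun A S t := fun t ht hts => by
    by_contra hc
    exact absurd (csInf_le hbd (show t ∈ T from ⟨hts, not_lt.mp hc⟩)) (not_le.mpr ht)
  have he : 0 < min e1 e2 := lt_min he1 he2
  have hle1 := min_le_left e1 e2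
  have hle2 := min_le_right e1 e2
  set e := min e1 e2
  obtain ⟨t, htT, htp⟩ := exists_lt_of_csInf_lt hne (show sInf T < p + e by linarith)
  have hpt : p ≤ t := csInf_le hbd htT
  have em : ∀ B : Set ℝ, (∀ x ∈ B, x ≠ p → e ≤ |x - p|) → B ∩ Set.Ioc p t = ∅ := by
    intro B g
    rw [Set.eq_empty_iff_forall_notMem]
    rintro x ⟨hx, hx1, hx2⟩
    have := g x hx hx1.ne'
    rw [abs_of_pos (by linarith)] at this
    linarith
  have gA : ∀ x ∈ A, x ≠ p → e ≤ |x - p| := fun x hx hxp => hle1.trans (g1 x hx hxp)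
  have gS : ∀ x ∈ S, x ≠ p → e ≤ |x - p| := fun x hx hxp => hle2.trans (g2 x hx hxp)
  have hps : p ≤ s := hpt.trans htT.1
  have hZp : Zfun A S p ≤ k := by
    have := aux_incr hA hS hpt
    rw [em A gA, em S gS] at this
    have h5 := htT.2
    simp at this
    omega
  have sub : S ∩ Set.Ioc (p - e / 2) p ⊆ S ∩ {p} := by
    rintro x ⟨hx, hx1, hx2⟩
    refine ⟨hx, ?_⟩
    by_contra hxp
    have := gS x hx hxp
    rw [abs_of_nonpos (by linarith)] at this
    linarith
  have hq := hlt (p - e / 2) (by linarith) (by linarith)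
  have inc := aux_incr hA hS (show p - e / 2 ≤ p by linarith)
  have c1 : (S ∩ Set.Ioc (p - e / 2) p).ncard ≤ 1 := by
    have := Set.ncard_le_ncard (sub.trans Set.inter_subset_right)
    simpa using this
  have hpS : p ∈ S := by
    by_contra hc
    have : S ∩ Set.Ioc (p - e / 2) p = ∅ := by
      rw [Set.eq_empty_iff_forall_notMem]
      intro x hx
      obtain ⟨h6, h7⟩ := sub hx
      rw [Set.mem_singleton_iff] at h7
      exact hc (h7 ▸ h6)
    rw [this] at inc
    simp at inc
    omega
  refine ⟨p, hps, ⟨hpS, fun r' hr' => ?_⟩, ?_⟩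
  · exact hZp.trans_lt (hlt r' hr' (hr'.le.trans hps))
  · omega

/-- For an admissible pair `(A,S)` and reals `r < s`, the number of unused
service times in `(r,s]` equals the decrease of the running minimum of `Z`:
`|U(A,S) ∩ (r,s]| = min_{r' ≤ r} Z_{r'} - min_{r' ≤ s} Z_{r'}`. -/
theorem unused_count_eq_running_min_decrease (A S : Set ℝ) (h : Admissible A S)
    (r s : ℝ) (hrs : r < s) :
    ((Unused A S ∩ Set.Ioc r s).ncard : ℤ) =
      sInf (Zfun A S '' Set.Iic r) - sInf (Zfun A S '' Set.Iic s) := by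
  have hne : ∀ x, (Zfun A S '' Set.Iic x).Nonempty := fun x => ⟨_, x, le_refl x, rfl⟩
  have hbd := aux_bdd h
  have hmono : sInf (Zfun A S '' Set.Iic s) ≤ sInf (Zfun A S '' Set.Iic r) :=
    csInf_le_csInf (hbd s) (hne r) (Set.image_mono (Set.Iic_subset_Iic.mpr hrs.le))
  have himg : Zfun A S '' (Unused A S ∩ Set.Ioc r s) =
      ↑(Finset.Ico (sInf (Zfun A S '' Set.Iic s)) (sInf (Zfun A S '' Set.Iic r))) := by
    ext k
    rw [Finset.coe_Ico]
    constructor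
    · rintro ⟨p, ⟨hp, hp1, hp2⟩, rfl⟩
      refine ⟨csInf_le (hbd s) ⟨p, hp2, rfl⟩, ?_⟩
      obtain ⟨t, ht, hte⟩ := Int.csInf_mem (hne r) (hbd r)
      rw [← hte]
      exact hp.2 t (lt_of_le_of_lt ht hp1)
    · rintro ⟨hk1, hk2⟩
      obtain ⟨t, ht, hte⟩ := Int.csInf_mem (hne s) (hbd s)
      obtain ⟨p, hps, hp, hpk⟩ := aux_surj h (s := s) (k := k) ⟨t, ht, hte ▸ hk1⟩
      refine ⟨p, ⟨hp, ?_, hps⟩, hpk⟩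
      by_contra hc
      have := csInf_le (hbd r) (Set.mem_image_of_mem _ (show p ∈ Set.Iic r from not_lt.mp hc))
      omega
  have hinj : Set.InjOn (Zfun A S) (Unused A S ∩ Set.Ioc r s) := by
    intro x hx y hy hxy
    rcases lt_trichotomy x y with hl | hl | hl
    · exact absurd (hy.1.2 x hl) (by omega)
    · exact hl
    · exact absurd (hx.1.2 y hl) (by omega)
  rw [← Set.ncard_image_of_injOn hinj, himg, Set.ncard_coe_finset, Int.card_Ico]
  omega
end
end

section
/- Let (A,S) be an admissible arrival–service pair and define the queue length Q_r = Z_r − min_{r' ≤ r} Z_{r'}. Then for all real r < s, the number of departures in (r,s] satisfies |D(A,S) ∩ (r,s]| = |A ∩ (r,s]| + Q_r − Q_s. -/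
open Set Filter Classical

noncomputable section

theorem LocFin.fin {B : Set ℝ} (h : LocFin B) (a b : ℝ) : (B ∩ Set.Ioc a b).Finite :=
  (h a b).subset (Set.inter_subset_inter_right _ Set.Ioc_subset_Icc_self)

theorem LocFin.split {B : Set ℝ} (h : LocFin B) {a b c : ℝ} (hab : a ≤ b) (hbc : b ≤ c) :
    (B ∩ Set.Ioc a c).ncard = (B ∩ Set.Ioc a b).ncard + (B ∩ Set.Ioc b c).ncard := by
  rw [← Set.ncard_union_eq _ (h.fin a b) (h.fin b c), ← Set.inter_union_distrib_left,
    Set.Ioc_union_Ioc_eq_Ioc hab hbc]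
  rw [Set.disjoint_left]
  rintro x ⟨_, hx⟩ ⟨_, hy⟩
  exact absurd hx.2 (not_le.2 hy.1)

theorem Zfun_inc {A S : Set ℝ} (hA : LocFin A) (hS : LocFin S) {r s : ℝ} (hrs : r ≤ s) :
    Zfun A S s - Zfun A S r = ((A ∩ Set.Ioc r s).ncard : ℤ) - ((S ∩ Set.Ioc r s).ncard : ℤ) := by
  unfold Zfun
  by_cases h1 : 0 ≤ r
  · rw [if_pos h1, if_pos (h1.trans hrs), hA.split h1 hrs, hS.split h1 hrs]
    push_cast; ring
  · by_cases h2 : 0 ≤ s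
    · rw [if_neg h1, if_pos h2, hA.split (not_le.1 h1).le h2, hS.split (not_le.1 h1).le h2]
      push_cast; ring
    · rw [if_neg h1, if_neg h2, hA.split hrs (not_le.1 h2).le, hS.split hrs (not_le.1 h2).le]
      push_cast; ring

theorem Zfun_drop {A S : Set ℝ} (hA : LocFin A) (hS : LocFin S) {x y : ℝ} (hxy : x < y)
    (hZ : Zfun A S y < Zfun A S x) : ∃ t ∈ S ∩ Set.Ioc x y, Zfun A S t ≤ Zfun A S y := by
  have hne : (S ∩ Set.Ioc x y).Nonempty := by
    by_contra hn
    rw [Set.not_nonempty_iff_eq_empty] at hn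
    have := Zfun_inc hA hS hxy.le
    rw [hn, Set.ncard_empty] at this
    omega
  obtain ⟨t, ht, hmax⟩ := Set.exists_max_image _ id (hS.fin x y) hne
  refine ⟨t, ht, ?_⟩
  have h1 := Zfun_inc hA hS ht.2.2
  have h2 : S ∩ Set.Ioc t y = ∅ := by
    rw [Set.eq_empty_iff_forall_notMem]
    rintro u ⟨hu, hu1, hu2⟩
    have := hmax u ⟨hu, ht.2.1.trans hu1, hu2⟩
    simp only [id] at this
    linarith
  rw [h2, Set.ncard_empty] at h1
  omega

theorem Zfun_step {A S : Set ℝ} (hA : LocFin A) (hS : LocFin S) {r t : ℝ} (hrt : r < t) :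
    ∃ u < t, Zfun A S u - 1 ≤ Zfun A S t := by
  have key : ∀ u < t, (∀ v ∈ S, u < v → v < t → False) → Zfun A S u - 1 ≤ Zfun A S t := by
    intro u hu hv
    have h1 := Zfun_inc hA hS hu.le
    have h2 : S ∩ Set.Ioc u t ⊆ {t} := by
      rintro v ⟨hvS, hv1, hv2⟩
      rcases hv2.lt_or_eq with h | h
      · exact (hv v hvS hv1 h).elim
      · exact h
    have h3 := Set.ncard_le_ncard h2
    rw [Set.ncard_singleton] at h3
    omega
  by_cases hne : (S ∩ Set.Ioo r t).Nonempty
  · obtain ⟨u, hu, hmax⟩ := Set.exists_max_image _ id ((hS.fin r t).subset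
      (Set.inter_subset_inter_right _ Set.Ioo_subset_Ioc_self)) hne
    refine ⟨u, hu.2.2, key u hu.2.2 fun v hv h1 h2 => ?_⟩
    have := hmax v ⟨hv, hu.2.1.trans h1, h2⟩
    simp only [id] at this
    linarith
  · exact ⟨r, hrt, key r hrt fun v hv h1 h2 => hne ⟨v, hv, h1, h2⟩⟩

theorem Zfun_bdd {A S : Set ℝ} (h : Admissible A S) (r : ℝ) :
    BddBelow (Zfun A S '' Set.Iic r) := by
  obtain ⟨hA, hS, -, -, hb⟩ := h
  obtain ⟨N, hN⟩ := Filter.eventually_atBot.1 (hb.eventually_ge_atTop 0)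
  refine ⟨min 0 (Zfun A S N - ((S ∩ Set.Ioc N r).ncard : ℤ)), ?_⟩
  rintro _ ⟨x, hx, rfl⟩
  rcases le_total x N with hxN | hxN
  · exact (min_le_left _ _).trans (hN x hxN)
  · refine (min_le_right _ _).trans ?_
    have h1 := Zfun_inc hA hS hxN
    have h2 := hS.split hxN hx
    omega

theorem unused_count {A S : Set ℝ} (h : Admissible A S) {r s : ℝ} (hrs : r < s) :
    ((Unused A S ∩ Set.Ioc r s).ncard : ℤ) =
      sInf (Zfun A S '' Set.Iic r) - sInf (Zfun A S '' Set.Iic s) := by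
  have hA := h.1
  have hS := h.2.1
  have hr := Zfun_bdd h r
  have hs := Zfun_bdd h s
  obtain ⟨a, ha, ha'⟩ := Int.csInf_mem (Set.Nonempty.image (Zfun A S) (Set.nonempty_Iic (a := r))) hr
  obtain ⟨b, hb, hb'⟩ := Int.csInf_mem (Set.Nonempty.image (Zfun A S) (Set.nonempty_Iic (a := s))) hs
  have hr' : ∀ x ≤ r, sInf (Zfun A S '' Set.Iic r) ≤ Zfun A S x :=
    fun x hx => csInf_le hr ⟨x, hx, rfl⟩
  have hs' : ∀ x ≤ s, sInf (Zfun A S '' Set.Iic s) ≤ Zfun A S x :=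
    fun x hx => csInf_le hs ⟨x, hx, rfl⟩
  generalize sInf (Zfun A S '' Set.Iic r) = m at *
  generalize sInf (Zfun A S '' Set.Iic s) = n at *
  simp only [Set.mem_Iic] at ha hb
  have hnm : n ≤ m := ha' ▸ hs' a (ha.trans hrs.le)
  have himg : Zfun A S '' (Unused A S ∩ Set.Ioc r s) = Set.Ico n m := by
    apply Set.Subset.antisymm
    · rintro _ ⟨u, ⟨hu, hu1, hu2⟩, rfl⟩
      exact ⟨hs' u hu2, ha' ▸ hu.2 a (ha.trans_lt hu1)⟩
    · rintro k ⟨hk1, hk2⟩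
      have hdrop : ∀ y, r < y → Zfun A S y ≤ k →
          ∃ t ∈ S ∩ Set.Ioc r y, Zfun A S t ≤ k := by
        intro y hy hyk
        obtain ⟨t, ht, ht'⟩ := Zfun_drop hA hS hy (by have := hr' r le_rfl; omega)
        exact ⟨t, ht, ht'.trans hyk⟩
      have hrb : r < b := by
        by_contra hc
        have := hr' b (not_lt.1 hc)
        omega
      obtain ⟨t0, ht0, ht0'⟩ := hdrop b hrb (by omega)
      obtain ⟨t, ⟨ht, htk⟩, hmin⟩ := Set.exists_min_image
        ((S ∩ Set.Ioc r s) ∩ {t | Zfun A S t ≤ k}) id ((hS.fin r s).subset Set.inter_subset_left)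
        ⟨t0, ⟨ht0.1, ht0.2.1, ht0.2.2.trans hb⟩, ht0'⟩
      simp only [Set.mem_setOf_eq] at htk
      have hlt : ∀ x < t, k < Zfun A S x := by
        intro x hx
        by_contra hc
        have hc := not_lt.1 hc
        have hrx : r < x := by
          by_contra hc'
          have := hr' x (not_lt.1 hc')
          omega
        obtain ⟨v, hv, hv'⟩ := hdrop x hrx hc
        have := hmin v ⟨⟨hv.1, hv.2.1, hv.2.2.trans (hx.le.trans ht.2.2)⟩, hv'⟩
        simp only [id] at this
        linarith [hv.2.2]
      refine ⟨t, ⟨⟨ht.1, fun x hx => htk.trans_lt (hlt x hx)⟩, ht.2⟩, ?_⟩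
      obtain ⟨u, hu, hu'⟩ := Zfun_step hA hS ht.2.1
      have := hlt u hu
      omega
  have hinj : Set.InjOn (Zfun A S) (Unused A S ∩ Set.Ioc r s) := by
    rintro x ⟨hx, _⟩ y ⟨hy, _⟩ hxy
    rcases lt_trichotomy x y with hl | hl | hl
    · exact absurd hxy (hy.2 x hl).ne'
    · exact hl
    · exact absurd hxy (hx.2 y hl).ne
  rw [← Set.ncard_image_of_injOn hinj, himg, ← Finset.coe_Ico, Set.ncard_coe_finset, Int.card_Ico]
  omega

/-- For an admissible pair `(A,S)`, with queue length
`Q_r = Z_r - min_{r' ≤ r} Z_{r'}`, for all reals `r < s`: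
`|D(A,S) ∩ (r,s]| = |A ∩ (r,s]| + Q_r - Q_s`. -/
theorem departures_count_eq (A S : Set ℝ) (h : Admissible A S) (r s : ℝ) (hrs : r < s) :
    ((Dep A S ∩ Set.Ioc r s).ncard : ℤ) =
      ((A ∩ Set.Ioc r s).ncard : ℤ) + Qlen A S r - Qlen A S s := by
  have hU := unused_count h hrs
  have hZ := Zfun_inc h.1 h.2.1 hrs.le
  have hsub : Unused A S ∩ Set.Ioc r s ⊆ S ∩ Set.Ioc r s :=
    Set.inter_subset_inter_left _ fun x hx => hx.1
  have hD : Dep A S ∩ Set.Ioc r s = (S ∩ Set.Ioc r s) \ (Unused A S ∩ Set.Ioc r s) := by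
    ext x
    simp only [Dep, Set.mem_inter_iff, Set.mem_diff]
    tauto
  have hc := Set.ncard_diff_add_ncard_of_subset hsub (h.2.1.fin r s)
  rw [← hD] at hc
  unfold Qlen
  omega
end
end
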